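/- Let ν be a probability measure on ℝ with continuous positive density f with respect to the standard Gaussian measure γ, and let T = F_ν^{-1} ∘ F_γ be the increasing transport map pushing γ forward onto ν. Then 2 H(ν|γ) − W₂²(ν, γ) ≥ (1/2) (∫_ℝ |1−T′|/max(1,T′) dγ)² = (1/2) d(φ, fφ)². -/

import Mathlib

open MeasureTheory Real Filter Asymptotics
open scoped ENNReal Topology

noncomputable section

/-- `ℝⁿ` with the Euclidean structure. -/
abbrev En (n : ℕ) := EuclideanSpace ℝ (Fin n)

/-- Density `φₙ` of the standard Gaussian measure on `ℝⁿ`. -/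
def phiN (n : ℕ) (x : En n) : ℝ := (2 * π) ^ (-(n : ℝ) / 2) * Real.exp (-‖x‖ ^ 2 / 2)

/-- The standard Gaussian measure `γₙ` on `ℝⁿ`. -/
def gaussianN (n : ℕ) : Measure (En n) :=
  volume.withDensity fun x => ENNReal.ofReal (phiN n x)

/-- Density `φ` of the standard Gaussian measure on `ℝ`. -/
def phi1 (x : ℝ) : ℝ := (2 * π) ^ (-(1 : ℝ) / 2) * Real.exp (-x ^ 2 / 2)

/-- The standard Gaussian measure `γ` on `ℝ`. -/
def gaussian1 : Measure ℝ := volume.withDensity fun x => ENNReal.ofReal (phi1 x)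

/-- Entropy `Ent_μ(f) = ∫ f log f dμ - (∫ f dμ) log (∫ f dμ)`. -/
def gEnt {α : Type*} [MeasurableSpace α] (μ : Measure α) (f : α → ℝ) : ℝ :=
  (∫ x, f x * Real.log (f x) ∂μ) - (∫ x, f x ∂μ) * Real.log (∫ x, f x ∂μ)

/-- Cumulative distribution function of the measure with density `u` on `ℝ`. -/
def cdfD (u : ℝ → ℝ) (x : ℝ) : ℝ := ∫ y in Set.Iic x, u y

/-- (Generalized) inverse of the cumulative distribution function of the density `v`. -/
def invCdfD (v : ℝ → ℝ) (t : ℝ) : ℝ := sInf {y : ℝ | t ≤ cdfD v y}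

/-- The increasing map `T = F_ν⁻¹ ∘ F_μ` transporting `μ(dx) = u(x)dx` onto `ν(dx) = v(x)dx`. -/
def transportD (u v : ℝ → ℝ) (x : ℝ) : ℝ := invCdfD v (cdfD u x)

/-- The Bucur–Fragalà distance (modulo translation)
`d(u,v) = ∫ |1 - T'| / max 1 T' dμ` between one-dimensional densities. -/
def dBF (u v : ℝ → ℝ) : ℝ :=
  ∫ x, |1 - deriv (transportD u v) x| / max 1 (deriv (transportD u v) x) * u x

/-- The squared Kantorovich–Wasserstein distance `W₂²(μ,ν)` between measures on `ℝ`: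
the infimum of `∬ |x-y|² dπ` over all couplings `π` of `μ` and `ν`. -/
def W2sqR (μ ν : Measure ℝ) : ℝ≥0∞ :=
  ⨅ (cpl : Measure (ℝ × ℝ)) (_ : cpl.map Prod.fst = μ) (_ : cpl.map Prod.snd = ν),
    ∫⁻ p, ENNReal.ofReal ((p.1 - p.2) ^ 2) ∂cpl

section helpers

lemma aux_wd_integrable (μ : Measure ℝ) (u g : ℝ → ℝ) (hu : Measurable u) (h0 : ∀ x, 0 ≤ u x) :
    Integrable g (μ.withDensity fun x => ENNReal.ofReal (u x)) ↔
      Integrable (fun x => g x * u x) μ := by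
  rw [integrable_withDensity_iff hu.ennreal_ofReal (by simp)]
  simp [ENNReal.toReal_ofReal (h0 _)]

lemma aux_wd_integral (μ : Measure ℝ) (u g : ℝ → ℝ) (hu : Measurable u) (h0 : ∀ x, 0 ≤ u x) :
    ∫ x, g x ∂(μ.withDensity fun x => ENNReal.ofReal (u x)) = ∫ x, g x * u x ∂μ := by
  rw [integral_withDensity_eq_integral_toReal_smul hu.ennreal_ofReal (by simp)]
  simp [ENNReal.toReal_ofReal (h0 _), mul_comm]

lemma aux_phi_eq : phi1 = ProbabilityTheory.gaussianPDFReal 0 1 := by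
  funext x
  have : ((2 * π) ^ (-(1 : ℝ) / 2) : ℝ) = (√(2 * π))⁻¹ := by
    rw [Real.sqrt_eq_rpow, ← Real.rpow_neg (by positivity)]
    norm_num
  simp [phi1, ProbabilityTheory.gaussianPDFReal, this]

lemma aux_gauss_eq : gaussian1 = ProbabilityTheory.gaussianReal 0 1 := by
  rw [ProbabilityTheory.gaussianReal_of_var_ne_zero _ one_ne_zero, gaussian1, aux_phi_eq]
  rfl

instance aux_gauss_prob : IsProbabilityMeasure gaussian1 := by
  rw [aux_gauss_eq]; infer_instance

lemma aux_phi_pos (x : ℝ) : 0 < phi1 x := by unfold phi1; positivity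

lemma aux_phi_cont : Continuous phi1 := by unfold phi1; fun_prop

lemma aux_phi_deriv (x : ℝ) : HasDerivAt phi1 (-(x * phi1 x)) x := by
  have h : HasDerivAt (fun x : ℝ => -x ^ 2 / 2) (-x) x := by
    have := ((hasDerivAt_pow 2 x).neg.div_const 2)
    refine this.congr_deriv ?_
    norm_num
    ring
  refine (h.exp.const_mul ((2 * π) ^ (-(1 : ℝ) / 2))).congr_deriv ?_
  unfold phi1; ring

lemma aux_g_integrable (g : ℝ → ℝ) :
    Integrable g gaussian1 ↔ Integrable (fun x => g x * phi1 x) :=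
  aux_wd_integrable _ _ _ aux_phi_cont.measurable fun x => (aux_phi_pos x).le

lemma aux_g_integral (g : ℝ → ℝ) :
    ∫ x, g x ∂gaussian1 = ∫ x, g x * phi1 x :=
  aux_wd_integral _ _ _ aux_phi_cont.measurable fun x => (aux_phi_pos x).le

lemma aux_phi_integrable : Integrable phi1 := by
  have := (aux_g_integrable (fun _ => 1)).1 (integrable_const _)
  simpa using this

lemma aux_memLp : MemLp (fun x : ℝ => x) 2 gaussian1 := by
  rw [aux_gauss_eq]
  exact ProbabilityTheory.memLp_id_gaussianReal 2

lemma aux_mean : ∫ x, x ∂gaussian1 = 0 := by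
  rw [aux_gauss_eq]; simp

lemma aux_second : ∫ x, x ^ 2 ∂gaussian1 = 1 := by
  have h := ProbabilityTheory.variance_eq_sub (μ := gaussian1) aux_memLp
  rw [aux_mean] at h
  rw [aux_gauss_eq] at h ⊢
  rw [ProbabilityTheory.variance_fun_id_gaussianReal] at h
  simpa using h.symm

lemma aux_exp_int : Integrable (fun x : ℝ => Real.exp (x ^ 2 / 4)) gaussian1 := by
  rw [aux_g_integrable]
  have := (integrable_exp_neg_mul_sq (b := 1 / 4) (by norm_num)).const_mul
    ((2 * π) ^ (-(1 : ℝ) / 2))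
  refine this.congr (ae_of_all _ fun x => ?_)
  simp only [phi1]
  rw [mul_left_comm, ← Real.exp_add]
  ring_nf

lemma aux_phi_tendsto_top : Tendsto phi1 atTop (𝓝 0) := by
  have : Tendsto (fun x : ℝ => -x ^ 2 / 2) atTop atBot := by
    have := (tendsto_pow_atTop (α := ℝ) two_ne_zero).atTop_div_const (r := 2) (by norm_num)
    refine (tendsto_neg_atTop_atBot.comp this).congr fun x => ?_
    simp [neg_div]
  have := (Real.tendsto_exp_atBot.comp this).const_mul ((2 * π) ^ (-(1 : ℝ) / 2))
  simpa [phi1, Function.comp_def] using! this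

lemma aux_phi_tendsto_bot : Tendsto phi1 atBot (𝓝 0) := by
  refine (aux_phi_tendsto_top.comp tendsto_neg_atBot_atTop).congr fun x => ?_
  simp [phi1]

lemma aux_xphi_int : Integrable (fun x => x * phi1 x) :=
  (aux_g_integrable _).1 (aux_memLp.integrable (by norm_num))

lemma aux_tail_top (b : ℝ) : ∫ x in Set.Ioi b, x * phi1 x = phi1 b := by
  have := integral_Ioi_of_hasDerivAt_of_tendsto' (a := b) (m := 0) (f := phi1)
    (fun x _ => aux_phi_deriv x) aux_xphi_int.neg.integrableOn aux_phi_tendsto_top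
  rw [integral_neg] at this
  linarith

lemma aux_tail_bot (a : ℝ) : ∫ x in Set.Iic a, x * phi1 x = -phi1 a := by
  have := integral_Iic_of_hasDerivAt_of_tendsto' (a := a) (m := 0) (f := phi1)
    (fun x _ => aux_phi_deriv x) aux_xphi_int.neg.integrableOn aux_phi_tendsto_bot
  rw [integral_neg] at this
  linarith


structure NiceD (v : ℝ → ℝ) : Prop where
  cont : Continuous v
  pos : ∀ x, 0 < v x
  prob : IsProbabilityMeasure (volume.withDensity fun x => ENNReal.ofReal (v x))

lemma NiceD.integrable {v : ℝ → ℝ} (h : NiceD v) : Integrable v := by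
  have := h.prob
  have := (aux_wd_integrable volume v (fun _ => 1) h.cont.measurable fun x => (h.pos x).le).1
    (integrable_const _)
  simpa using this

lemma NiceD.cdf_eq {v : ℝ → ℝ} (h : NiceD v) (x : ℝ) :
    cdfD v x = ProbabilityTheory.cdf (volume.withDensity fun x => ENNReal.ofReal (v x)) x := by
  have := h.prob
  rw [ProbabilityTheory.cdf_eq_real, Measure.real, withDensity_apply _ measurableSet_Iic,
    ← ofReal_integral_eq_lintegral_ofReal h.integrable.integrableOn
      (ae_of_all _ fun x => (h.pos x).le), ENNReal.toReal_ofReal]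
  · rfl
  · exact integral_nonneg fun x => (h.pos x).le

lemma NiceD.hasDerivAt {v : ℝ → ℝ} (h : NiceD v) (x : ℝ) : HasDerivAt (cdfD v) (v x) x := by
  have h1 : cdfD v = fun x => (∫ y in (0:ℝ)..x, v y) + cdfD v 0 := by
    funext x
    rw [← intervalIntegral.integral_Iic_sub_Iic h.integrable.integrableOn
      h.integrable.integrableOn]
    simp [cdfD]
  rw [h1]
  exact (intervalIntegral.integral_hasDerivAt_right (h.cont.intervalIntegrable _ _)
    h.cont.stronglyMeasurable.stronglyMeasurableAtFilter h.cont.continuousAt).add_const _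

lemma NiceD.strictMono {v : ℝ → ℝ} (h : NiceD v) : StrictMono (cdfD v) :=
  strictMono_of_hasDerivAt_pos h.hasDerivAt h.pos

lemma NiceD.continuous {v : ℝ → ℝ} (h : NiceD v) : Continuous (cdfD v) :=
  continuous_iff_continuousAt.2 fun x => (h.hasDerivAt x).continuousAt

lemma NiceD.cdf_pos {v : ℝ → ℝ} (h : NiceD v) (x : ℝ) : 0 < cdfD v x := by
  have := h.strictMono (show x - 1 < x by linarith)
  have h2 : 0 ≤ cdfD v (x - 1) := by rw [h.cdf_eq]; exact ProbabilityTheory.cdf_nonneg _ _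
  linarith

lemma NiceD.cdf_lt {v : ℝ → ℝ} (h : NiceD v) (x : ℝ) : cdfD v x < 1 := by
  have := h.strictMono (show x < x + 1 by linarith)
  have h2 : cdfD v (x + 1) ≤ 1 := by rw [h.cdf_eq]; exact ProbabilityTheory.cdf_le_one _ _
  linarith

lemma NiceD.exists_eq {v : ℝ → ℝ} (h : NiceD v) (t : ℝ) (h0 : 0 < t) (h1 : t < 1) :
    ∃ y, cdfD v y = t := by
  have e : cdfD v = ProbabilityTheory.cdf (volume.withDensity fun x => ENNReal.ofReal (v x)) :=
    funext h.cdf_eq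
  have a := ProbabilityTheory.tendsto_cdf_atBot
    (volume.withDensity fun x => ENNReal.ofReal (v x))
  have b := ProbabilityTheory.tendsto_cdf_atTop
    (volume.withDensity fun x => ENNReal.ofReal (v x))
  rw [← e] at a b
  obtain ⟨y0, hy0⟩ := (a.eventually (gt_mem_nhds h0)).exists
  obtain ⟨y1, hy1⟩ := (b.eventually (lt_mem_nhds h1)).exists
  exact mem_range_of_exists_le_of_exists_ge h.continuous ⟨y0, hy0.le⟩ ⟨y1, hy1.le⟩

lemma aux_transport {u v : ℝ → ℝ} (hu : NiceD u) (hv : NiceD v) (x : ℝ) :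
    cdfD v (transportD u v x) = cdfD u x := by
  obtain ⟨y, hy⟩ := hv.exists_eq _ (hu.cdf_pos x) (hu.cdf_lt x)
  have : {z : ℝ | cdfD u x ≤ cdfD v z} = Set.Ici y := by
    ext z
    simp [← hy, hv.strictMono.le_iff_le]
  rw [transportD, invCdfD, this, csInf_Ici, hy]

lemma aux_T_strictMono {u v : ℝ → ℝ} (hu : NiceD u) (hv : NiceD v) :
    StrictMono (transportD u v) := by
  intro x y hxy
  rw [← hv.strictMono.lt_iff_lt, aux_transport hu hv, aux_transport hu hv]
  exact hu.strictMono hxy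

lemma aux_T_cont {u v : ℝ → ℝ} (hu : NiceD u) (hv : NiceD v) :
    Continuous (transportD u v) := by
  refine (aux_T_strictMono hu hv).monotone.continuous_of_surjective fun y => ?_
  obtain ⟨x, hx⟩ := hu.exists_eq _ (hv.cdf_pos y) (hv.cdf_lt y)
  refine ⟨x, hv.strictMono.injective ?_⟩
  rw [aux_transport hu hv, hx]

lemma aux_T_deriv {u v : ℝ → ℝ} (hu : NiceD u) (hv : NiceD v) (x : ℝ) :
    HasDerivAt (transportD u v) (u x / v (transportD u v x)) x := by
  have hTc := (aux_T_cont hu hv).continuousAt (x := x)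
  have h1 := (hv.hasDerivAt (transportD u v x)).tendsto_slope
  have hcomp : Tendsto (transportD u v) (𝓝[≠] x) (𝓝[≠] (transportD u v x)) :=
    tendsto_nhdsWithin_iff.2 ⟨hTc.tendsto.mono_left nhdsWithin_le_nhds,
      eventually_nhdsWithin_of_forall fun y hy => (aux_T_strictMono hu hv).injective.ne hy⟩
  have h2 := (hu.hasDerivAt x).tendsto_slope
  rw [hasDerivAt_iff_tendsto_slope]
  refine (h2.div (h1.comp hcomp) (hv.pos _).ne').congr' ?_
  refine eventually_nhdsWithin_of_forall fun y hy => ?_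
  have hne : transportD u v y - transportD u v x ≠ 0 :=
    sub_ne_zero.2 ((aux_T_strictMono hu hv).injective.ne hy)
  have hne2 : cdfD u y - cdfD u x ≠ 0 :=
    sub_ne_zero.2 (hu.strictMono.injective.ne hy)
  have hne3 : y - x ≠ 0 := sub_ne_zero.2 hy
  simp only [Pi.div_apply, Function.comp, slope_def_field, aux_transport hu hv]
  field_simp

lemma aux_T_map {u v : ℝ → ℝ} (hu : NiceD u) (hv : NiceD v) :
    (volume.withDensity fun x => ENNReal.ofReal (u x)).map (transportD u v) =
      volume.withDensity fun x => ENNReal.ofReal (v x) := by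
  have := hu.prob
  have := hv.prob
  have hm := (aux_T_cont hu hv).measurable
  have := Measure.isProbabilityMeasure_map (μ := volume.withDensity fun x => ENNReal.ofReal (u x))
    hm.aemeasurable
  refine Measure.ext_of_Iic _ _ fun y => ?_
  obtain ⟨x, hx⟩ := hu.exists_eq _ (hv.cdf_pos y) (hv.cdf_lt y)
  rw [Measure.map_apply hm measurableSet_Iic]
  have hs : transportD u v ⁻¹' Set.Iic y = Set.Iic x := by
    ext z
    simp only [Set.mem_preimage, Set.mem_Iic]
    rw [← hv.strictMono.le_iff_le, aux_transport hu hv, ← hx, hu.strictMono.le_iff_le]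
  rw [hs, ← ProbabilityTheory.ofReal_cdf, ← ProbabilityTheory.ofReal_cdf, ← hu.cdf_eq,
    ← hv.cdf_eq, hx]


lemma aux_ibp (T t : ℝ → ℝ) (hd : ∀ x, HasDerivAt T (t x) x) (ht : Continuous t)
    (hm : Monotone T) (hi : Integrable (fun x => x * T x) gaussian1) (R : ℝ) (hR : 0 ≤ R) :
    ∫ x in (-R)..R, t x * phi1 x ≤ ∫ x, x * T x ∂gaussian1 := by
  have hTc : Continuous T := continuous_iff_continuousAt.2 fun x => (hd x).continuousAt
  have hpc := aux_phi_cont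
  have hx : Integrable (fun x : ℝ => x) gaussian1 := aux_memLp.integrable (by norm_num)
  have hUi : Integrable (fun x => x * (T x - T 0)) gaussian1 := by
    refine (hi.sub (hx.mul_const (T 0))).congr (ae_of_all _ fun x => ?_)
    simp only [Pi.sub_apply]; ring
  have hU : ∫ x, x * (T x - T 0) ∂gaussian1 = ∫ x, x * T x ∂gaussian1 := by
    have : (fun x => x * (T x - T 0)) = fun x => x * T x - x * T 0 := by funext x; ring
    rw [this, integral_sub hi (hx.mul_const _), integral_mul_const, aux_mean]
    simp
  rw [← hU, aux_g_integral]
  rw [aux_g_integrable] at hUi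
  have hftc : ∫ x in (-R)..R, (t x * phi1 x + (T x - T 0) * (-(x * phi1 x))) =
      (T R - T 0) * phi1 R - (T (-R) - T 0) * phi1 (-R) := by
    refine intervalIntegral.integral_eq_sub_of_hasDerivAt
      (f := fun x => (T x - T 0) * phi1 x) (fun x _ => ?_) ?_
    · exact ((hd x).sub_const (T 0)).mul (aux_phi_deriv x)
    · apply Continuous.intervalIntegrable; fun_prop
  have hsplit : ∫ x in (-R)..R, (t x * phi1 x + (T x - T 0) * (-(x * phi1 x))) =
      (∫ x in (-R)..R, t x * phi1 x) - ∫ x in (-R)..R, x * (T x - T 0) * phi1 x := by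
    rw [← intervalIntegral.integral_sub]
    · congr 1; funext x; ring
    · apply Continuous.intervalIntegrable; fun_prop
    · apply Continuous.intervalIntegrable; fun_prop
  have h1 : (T R - T 0) * phi1 R ≤ ∫ x in Set.Ioi R, x * (T x - T 0) * phi1 x := by
    rw [← aux_tail_top R, ← integral_const_mul]
    refine setIntegral_mono_on (aux_xphi_int.const_mul _).integrableOn hUi.integrableOn
      measurableSet_Ioi fun x hx => ?_
    have hx : R < x := hx
    have h3 : T R ≤ T x := hm hx.le
    have h4 : 0 ≤ x * phi1 x := mul_nonneg (by linarith) (aux_phi_pos x).le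
    nlinarith
  have h2 : -((T (-R) - T 0) * phi1 (-R)) ≤ ∫ x in Set.Iic (-R), x * (T x - T 0) * phi1 x := by
    rw [← mul_neg, ← aux_tail_bot (-R), ← integral_const_mul]
    refine setIntegral_mono_on (aux_xphi_int.const_mul _).integrableOn hUi.integrableOn
      measurableSet_Iic fun x hx => ?_
    have hx : x ≤ -R := hx
    have h3 : T x ≤ T (-R) := hm hx
    have h4 : 0 ≤ (-x) * phi1 x := mul_nonneg (by linarith) (aux_phi_pos x).le
    nlinarith
  have h5 := intervalIntegral.integral_Iic_sub_Iic (a := -R) (b := R) hUi.integrableOn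
    hUi.integrableOn
  have h6 := intervalIntegral.integral_Iic_add_Ioi (b := R) hUi.integrableOn hUi.integrableOn
  linarith

lemma aux_pointwise (t : ℝ) (ht : 0 < t) :
    (|1 - t| / max 1 t) ^ 2 / 4 ≤ t - 1 - Real.log t := by
  obtain ⟨r, hr, rfl⟩ : ∃ r : ℝ, 0 < r ∧ t = r ^ 2 :=
    ⟨√t, Real.sqrt_pos.2 ht, (Real.sq_sqrt ht.le).symm⟩
  have hl : Real.log (r ^ 2) ≤ 2 * (r - 1) := by
    rw [Real.log_pow]
    have := Real.log_le_sub_one_of_pos hr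
    push_cast
    linarith
  suffices h : (|1 - r ^ 2| / max 1 (r ^ 2)) ^ 2 / 4 ≤ (r - 1) ^ 2 by nlinarith
  rw [div_pow, sq_abs]
  rcases le_total 1 r with h | h
  · rw [max_eq_right (by nlinarith), div_div, div_le_iff₀ (by positivity)]
    have h1 : r + 1 ≤ 2 * r ^ 2 := by nlinarith
    have h2 : (r + 1) ^ 2 ≤ (2 * r ^ 2) ^ 2 := by gcongr
    nlinarith [mul_le_mul_of_nonneg_left h2 (sq_nonneg (r - 1))]
  · rw [max_eq_left (by nlinarith), div_div, div_le_iff₀ (by positivity)]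
    have h2 : (r + 1) ^ 2 ≤ 2 ^ 2 := by gcongr; linarith
    nlinarith [mul_le_mul_of_nonneg_left h2 (sq_nonneg (r - 1))]

lemma aux_young (a b : ℝ) (ha : 0 < a) : a * b ≤ a * Real.log a - a + Real.exp b := by
  have h := Real.add_one_le_exp (b - Real.log a)
  rw [Real.exp_sub, Real.exp_log ha, le_div_iff₀ ha] at h
  nlinarith

lemma aux_jensen (s : ℝ → ℝ) (hs : Integrable s gaussian1)
    (hs2 : Integrable (fun x => s x ^ 2) gaussian1) :
    (∫ x, s x ∂gaussian1) ^ 2 ≤ ∫ x, s x ^ 2 ∂gaussian1 := by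
  set m := ∫ x, s x ∂gaussian1 with hm
  have h0 : 0 ≤ ∫ x, (s x - m) ^ 2 ∂gaussian1 := integral_nonneg fun x => sq_nonneg _
  have e : (fun x => (s x - m) ^ 2) = fun x => s x ^ 2 - 2 * m * s x + m ^ 2 := by
    funext x; ring
  have hi1 : Integrable (fun x => s x ^ 2 - 2 * m * s x) gaussian1 :=
    hs2.sub (hs.const_mul (2 * m))
  rw [e, integral_add hi1 (integrable_const _),
    integral_sub hs2 (hs.const_mul _), integral_const_mul, ← hm] at h0
  simp at h0
  nlinarith

lemma aux_key (T t : ℝ → ℝ) (hd : ∀ x, HasDerivAt T (t x) x) (ht : Continuous t)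
    (hpos : ∀ x, 0 < t x) (hm : Monotone T) (hi : Integrable (fun x => x * T x) gaussian1)
    (hl : Integrable (fun x => Real.log (t x)) gaussian1) :
    (∫ x, |1 - t x| / max 1 (t x) ∂gaussian1) ^ 2 / 4 ≤
      (∫ x, x * T x ∂gaussian1) - 1 - ∫ x, Real.log (t x) ∂gaussian1 := by
  have hmax : ∀ x, 0 < max 1 (t x) := fun x => lt_max_of_lt_left one_pos
  have hsc : Continuous (fun x => |1 - t x| / max 1 (t x)) :=
    Continuous.div (by fun_prop) (by fun_prop) fun x => (hmax x).ne'
  have h01 : ∀ x, 0 ≤ |1 - t x| / max 1 (t x) := fun x => div_nonneg (abs_nonneg _) (hmax x).le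
  have hle : ∀ x, |1 - t x| / max 1 (t x) ≤ 1 := fun x => by
    rw [div_le_one (hmax x), abs_le]
    have := hpos x
    have h1 := le_max_left 1 (t x)
    have h2 := le_max_right 1 (t x)
    constructor <;> linarith
  have hs : Integrable (fun x => |1 - t x| / max 1 (t x)) gaussian1 :=
    Integrable.of_bound hsc.aestronglyMeasurable 1 (ae_of_all _ fun x => by
      rw [Real.norm_of_nonneg (h01 x)]; exact hle x)
  have hs2 : Integrable (fun x => (|1 - t x| / max 1 (t x)) ^ 2) gaussian1 :=
    Integrable.of_bound (hsc.pow 2).aestronglyMeasurable 1 (ae_of_all _ fun x => by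
      rw [Real.norm_of_nonneg (sq_nonneg _)]; exact pow_le_one₀ (h01 x) (hle x))
  have hj := aux_jensen _ hs hs2
  have hall : Integrable (fun x => (|1 - t x| / max 1 (t x)) ^ 2 / 4 + 1 + Real.log (t x))
    gaussian1 := ((hs2.div_const 4).add (integrable_const 1)).add hl
  have hsum : ∫ x, ((|1 - t x| / max 1 (t x)) ^ 2 / 4 + 1 + Real.log (t x)) ∂gaussian1 =
      (∫ x, (|1 - t x| / max 1 (t x)) ^ 2 ∂gaussian1) / 4 + 1 +
        ∫ x, Real.log (t x) ∂gaussian1 := by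
    have hi1 : Integrable (fun x => (|1 - t x| / max 1 (t x)) ^ 2 / 4 + 1) gaussian1 :=
      (hs2.div_const 4).add (integrable_const 1)
    rw [integral_add hi1 hl,
      integral_add (hs2.div_const 4) (integrable_const 1), integral_div]
    simp
  have hlim := intervalIntegral_tendsto_integral ((aux_g_integrable _).1 hall)
    tendsto_neg_atTop_atBot tendsto_id
  rw [← aux_g_integral, hsum] at hlim
  have hpc := aux_phi_cont
  have hlc : Continuous (fun x => Real.log (t x)) := ht.log fun x => (hpos x).ne'
  have hfin := le_of_tendsto hlim (b := ∫ x, x * T x ∂gaussian1) (by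
    filter_upwards [eventually_ge_atTop 0] with R hR
    refine le_trans ?_ (aux_ibp T t hd ht hm hi R hR)
    refine intervalIntegral.integral_mono_on (by simp; linarith) ?_ ?_ fun x _ => ?_
    · apply Continuous.intervalIntegrable; fun_prop
    · apply Continuous.intervalIntegrable; fun_prop
    · have := aux_pointwise (t x) (hpos x)
      exact mul_le_mul_of_nonneg_right (by linarith) (aux_phi_pos x).le)
  linarith

lemma aux_W2 (T : ℝ → ℝ) (hT : Continuous T) (ν : Measure ℝ) (hmap : gaussian1.map T = ν)
    (hi : Integrable (fun x => (T x - x) ^ 2) gaussian1) :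
    (W2sqR ν gaussian1).toReal ≤ ∫ x, (T x - x) ^ 2 ∂gaussian1 := by
  refine ENNReal.toReal_le_of_le_ofReal (integral_nonneg fun x => sq_nonneg _) ?_
  have hm : Measurable fun x => (T x, x) := by fun_prop
  have hm1 : (gaussian1.map fun x => (T x, x)).map Prod.fst = ν := by
    rw [Measure.map_map measurable_fst hm, ← hmap]; rfl
  have hm2 : (gaussian1.map fun x => (T x, x)).map Prod.snd = gaussian1 := by
    rw [Measure.map_map measurable_snd hm]; exact Measure.map_id
  refine iInf_le_of_le (gaussian1.map fun x => (T x, x)) (iInf_le_of_le hm1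
    (iInf_le_of_le hm2 ?_))
  rw [lintegral_map (by fun_prop) hm, ofReal_integral_eq_lintegral_ofReal hi
    (ae_of_all _ fun x => sq_nonneg _)]

lemma aux_phi_log (x : ℝ) :
    Real.log (phi1 x) = Real.log ((2 * π) ^ (-(1 : ℝ) / 2)) - x ^ 2 / 2 := by
  unfold phi1
  rw [Real.log_mul (by positivity) (by positivity), Real.log_exp]
  ring

end helpers

/-- One-dimensional stability of the Talagrand inequality: for a probability measure `ν`
on `ℝ` with continuous positive density `f` w.r.t. `γ` and `T = F_ν⁻¹ ∘ F_γ` the increasing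
transport map pushing `γ` onto `ν`,
`2H(ν|γ) - W₂²(ν,γ) ≥ (1/2)(∫ |1-T'|/max(1,T') dγ)² = (1/2) d(φ, fφ)²`. -/
theorem talagrand_deficit_dim_one (f : ℝ → ℝ) (hcont : Continuous f)
    (hpos : ∀ x, 0 < f x) (ν : Measure ℝ)
    (hν : ν = gaussian1.withDensity fun x => ENNReal.ofReal (f x))
    (hprob : IsProbabilityMeasure ν)
    (hH : Integrable (fun x => Real.log (f x)) ν)
    (T : ℝ → ℝ) (hT : T = transportD phi1 fun x => f x * phi1 x) :
    2 * (∫ x, Real.log (f x) ∂ν) - (W2sqR ν gaussian1).toReal ≥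
        (1 / 2) * (∫ x, |1 - deriv T x| / max 1 (deriv T x) ∂gaussian1) ^ 2 ∧
      (1 / 2) * (∫ x, |1 - deriv T x| / max 1 (deriv T x) ∂gaussian1) ^ 2 =
        (1 / 2) * dBF phi1 (fun x => f x * phi1 x) ^ 2 := by
  refine ⟨?_, ?_⟩
  swap
  · rw [aux_g_integral, dBF, hT]
  have hphi : NiceD phi1 := ⟨aux_phi_cont, aux_phi_pos, aux_gauss_prob⟩
  have hνv : ν = volume.withDensity fun x => ENNReal.ofReal (f x * phi1 x) := by
    rw [hν, gaussian1, ← withDensity_mul _ aux_phi_cont.measurable.ennreal_ofReal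
      hcont.measurable.ennreal_ofReal]
    congr 1
    funext x
    rw [Pi.mul_apply, ← ENNReal.ofReal_mul (aux_phi_pos x).le, mul_comm]
  have hv : NiceD (fun x => f x * phi1 x) :=
    ⟨hcont.mul aux_phi_cont, fun x => mul_pos (hpos x) (aux_phi_pos x), by
      rw [← hνv]; exact hprob⟩
  have hmap : gaussian1.map T = ν := by
    rw [hT, hνv]; exact aux_T_map hphi hv
  have hTc : Continuous T := by rw [hT]; exact aux_T_cont hphi hv
  have hTm : StrictMono T := by rw [hT]; exact aux_T_strictMono hphi hv
  have hd : ∀ x, HasDerivAt T (phi1 x / (f (T x) * phi1 (T x))) x := by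
    intro x; rw [hT]; exact aux_T_deriv hphi hv x
  have hderiv : deriv T = fun x => phi1 x / (f (T x) * phi1 (T x)) :=
    funext fun x => (hd x).deriv
  have hdpos : ∀ x, 0 < deriv T x := fun x => by
    rw [hderiv]; exact div_pos (aux_phi_pos x) (mul_pos (hpos _) (aux_phi_pos _))
  have hdc : Continuous (deriv T) := by
    rw [hderiv]
    have := aux_phi_cont
    exact Continuous.div (by fun_prop) (by fun_prop)
      fun x => (mul_pos (hpos _) (aux_phi_pos _)).ne'
  have hlogd : ∀ x, Real.log (f (T x)) = (T x ^ 2 - x ^ 2) / 2 - Real.log (deriv T x) := by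
    intro x
    rw [hderiv]
    simp only
    rw [Real.log_div (aux_phi_pos x).ne' (mul_pos (hpos _) (aux_phi_pos _)).ne',
      Real.log_mul (hpos _).ne' (aux_phi_pos _).ne', aux_phi_log, aux_phi_log]
    ring
  have hlogc : Continuous fun x => Real.log (f x) := hcont.log fun x => (hpos x).ne'
  have hsqν : Integrable (fun x : ℝ => x ^ 2) ν := by
    have hH' := hH
    have h1 : Integrable (fun _ : ℝ => (1 : ℝ)) ν := integrable_const _
    rw [hν, aux_wd_integrable _ _ _ hcont.measurable fun x => (hpos x).le] at hH' h1 ⊢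
    refine Integrable.mono' (((hH'.sub h1).add aux_exp_int).const_mul 4)
      (by fun_prop) (ae_of_all _ fun x => ?_)
    rw [Real.norm_of_nonneg (mul_nonneg (sq_nonneg _) (hpos x).le)]
    have := aux_young (f x) (x ^ 2 / 4) (hpos x)
    simp only [Pi.add_apply, Pi.sub_apply]
    linarith
  have hTsq : Integrable (fun x => T x ^ 2) gaussian1 := by
    rw [← hmap] at hsqν
    exact (integrable_map_measure (by fun_prop) hTc.aemeasurable).1 hsqν
  have hlogT : Integrable (fun x => Real.log (f (T x))) gaussian1 := by
    rw [← hmap] at hH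
    exact (integrable_map_measure hlogc.aestronglyMeasurable hTc.aemeasurable).1 hH
  have hTL : MemLp T 2 gaussian1 :=
    (memLp_two_iff_integrable_sq hTc.aestronglyMeasurable).2 hTsq
  have hxT : Integrable (fun x => x * T x) gaussian1 := aux_memLp.integrable_mul hTL
  have hxsq : Integrable (fun x : ℝ => x ^ 2) gaussian1 := aux_memLp.integrable_sq
  have hlogt : Integrable (fun x => Real.log (deriv T x)) gaussian1 := by
    refine (((hTsq.sub hxsq).div_const 2).sub hlogT).congr (ae_of_all _ fun x => ?_)
    simp only [Pi.sub_apply]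
    rw [hlogd]; ring
  have hkey := aux_key T (deriv T) (fun x => by rw [hderiv]; exact hd x) hdc hdpos
    hTm.monotone hxT hlogt
  have hTx : (fun x => (T x - x) ^ 2) = fun x => T x ^ 2 - 2 * (x * T x) + x ^ 2 := by
    funext x; ring
  have hTxi : Integrable (fun x => (T x - x) ^ 2) gaussian1 := by
    rw [hTx]; exact (hTsq.sub (hxT.const_mul 2)).add hxsq
  have hW := aux_W2 T hTc ν hmap hTxi
  have hi1 : Integrable (fun x => T x ^ 2 - 2 * (x * T x)) gaussian1 :=
    hTsq.sub (hxT.const_mul 2)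
  have hi2 : Integrable (fun x => (T x ^ 2 - x ^ 2) / 2) gaussian1 :=
    (hTsq.sub hxsq).div_const 2
  rw [hTx, integral_add hi1 hxsq, integral_sub hTsq (hxT.const_mul 2),
    integral_const_mul, aux_second] at hW
  have hent : ∫ x, Real.log (f x) ∂ν =
      ((∫ x, T x ^ 2 ∂gaussian1) - 1) / 2 - ∫ x, Real.log (deriv T x) ∂gaussian1 := by
    rw [← hmap, integral_map hTc.aemeasurable hlogc.aestronglyMeasurable]
    simp_rw [hlogd]
    rw [integral_sub hi2 hlogt, integral_div,
      integral_sub hTsq hxsq, aux_second]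
  rw [hent]
  linarith

end
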